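/- arXiv:1511.01307 — 9 statements merged into one kernel-verified Lean document; each statement's English description precedes it below -/
import Mathlib

section
/- Let ν ≥ 2, c ≥ ν−1, and α₁,…,α_ν > 0. Define the ν×ν matrix J^c by (J^c)_{aa} = c α_a² and (J^c)_{ab} = −α_a α_b for a ≠ b. Define vectors v¹,…,v^ν ∈ ℝ^ν by v¹ = √((c+1−ν)/ν)·(α₁,…,α_ν) and, for 2 ≤ a ≤ ν, vᵃ = √((c+1)/(a(a−1)))·(α₁,…,α_{a−1},(1−a)α_a,0,…,0). Then for all indices b, b' ∈ {1,…,ν} one has Σ_{a=1}^ν vᵃ_b vᵃ_{b'} = (J^c)_{b b'}; in particular J^c = PᵀP where P is the matrix whose rows are v¹,…,v^ν, and J^c is positive semidefinite. -/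
open Matrix Finset

/-- The coefficient at `b` of the vector `(1, …, 1, -i, 0, …, 0)` with `i` leading ones. -/
def helmertCoeff (i b : ℕ) : ℝ := if b < i then 1 else if b = i then -(i : ℝ) else 0

/-- Partial sums of the products of entries of the normalized Helmert vectors. -/
lemma sum_helmertCoeff_mul (n b b' : ℕ) :
    ∑ i ∈ range n, helmertCoeff (i + 1) b * helmertCoeff (i + 1) b' / (((i : ℝ) + 2) * (i + 1)) =
      if b ≤ n ∧ b' ≤ n then (if b = b' then 1 else 0) - 1 / ((n : ℝ) + 1) else 0 := by
  induction n with
  | zero =>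
    by_cases h : b ≤ 0 ∧ b' ≤ 0
    · obtain ⟨h, h'⟩ := h
      obtain rfl : b = 0 := by omega
      obtain rfl : b' = 0 := by omega
      simp
    · simp only [range_zero, sum_empty, if_neg h]
  | succ n ih =>
    have h1 : (n : ℝ) + 1 ≠ 0 := by positivity
    have h2 : (n : ℝ) + 2 ≠ 0 := by positivity
    have h3 : (n : ℝ) + 1 + 1 ≠ 0 := by positivity
    rw [sum_range_succ, ih]
    unfold helmertCoeff
    push_cast
    split_ifs <;> first | omega | (field_simp; ring)

theorem stmt_1 (ν : ℕ) (hν : 2 ≤ ν) (c : ℝ) (hc : (ν : ℝ) - 1 ≤ c)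
    (α : Fin ν → ℝ) (hα : ∀ a, 0 < α a)
    (J : Matrix (Fin ν) (Fin ν) ℝ)
    (hJ : ∀ a b, J a b = if a = b then c * (α a) ^ 2 else -(α a * α b))
    (v : Fin ν → Fin ν → ℝ)
    (hv0 : ∀ a : Fin ν, a.val = 0 → ∀ b, v a b = Real.sqrt ((c + 1 - ν) / ν) * α b)
    (hva : ∀ a : Fin ν, a.val ≠ 0 → ∀ b : Fin ν,
      v a b = Real.sqrt ((c + 1) / ((a.val + 1) * a.val)) *
        (if b.val < a.val then α b else if b = a then -(a.val : ℝ) * α a else 0)) :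
    (∀ b b' : Fin ν, ∑ a, v a b * v a b' = J b b') ∧
    ((Matrix.of v)ᵀ * (Matrix.of v) = J) ∧ J.PosSemidef := by
  have gram : ∀ b b' : Fin ν, ∑ a, v a b * v a b' = J b b' := by
    obtain ⟨n, rfl⟩ : ∃ n, ν = n + 1 := ⟨ν - 1, by omega⟩
    intro b b'
    have hn : (n : ℝ) + 1 ≠ 0 := by positivity
    push_cast at hc
    have hc0 : 0 ≤ c + 1 := by linarith [n.cast_nonneg (α := ℝ)]
    have entry : ∀ (i : Fin n) (d : Fin (n + 1)), v i.succ d =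
        Real.sqrt ((c + 1) / (((i : ℝ) + 2) * (i + 1))) *
          (helmertCoeff (i + 1) d * α d) := by
      intro i d
      rw [hva i.succ (by simp) d]
      have hs : (((i.succ : Fin (n + 1)) : ℕ) : ℝ) + 1 = (i : ℝ) + 2 := by
        push_cast [Fin.val_succ]; ring
      rw [hs]
      unfold helmertCoeff
      by_cases h : d = i.succ
      · subst h
        simp
      · have h' : (d : ℕ) ≠ i + 1 := fun e => h (Fin.ext (by simpa using e))
        simp [h, h']
    have term : ∀ i : Fin n, v i.succ b * v i.succ b' = (c + 1) * (α b * α b') *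
        (helmertCoeff (i + 1) b * helmertCoeff (i + 1) b' / (((i : ℝ) + 2) * (i + 1))) := by
      intro i
      have hs := Real.mul_self_sqrt
        (show 0 ≤ (c + 1) / (((i : ℝ) + 2) * (i + 1)) by positivity)
      rw [entry, entry, mul_mul_mul_comm, hs]
      ring
    have hs := Real.mul_self_sqrt
      (show 0 ≤ (c + 1 - ((n + 1 : ℕ) : ℝ)) / ((n + 1 : ℕ) : ℝ) from
        div_nonneg (by push_cast; linarith) (by positivity))
    rw [Fin.sum_univ_succ, hv0 0 rfl, hv0 0 rfl, mul_mul_mul_comm, hs]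
    simp_rw [term]
    rw [← mul_sum, Fin.sum_univ_eq_sum_range (fun i : ℕ =>
      helmertCoeff (i + 1) b * helmertCoeff (i + 1) b' / (((i : ℝ) + 2) * (i + 1))),
      sum_helmertCoeff_mul, if_pos ⟨by omega, by omega⟩, hJ]
    push_cast
    by_cases h : b = b'
    · subst h
      simp only [if_true]
      field_simp
      ring
    · rw [if_neg h, if_neg (fun e => h (Fin.ext e))]
      field_simp
      ring
  have factor : (Matrix.of v)ᵀ * (Matrix.of v) = J := by
    ext b b'
    simpa [Matrix.mul_apply] using gram b b'
  refine ⟨gram, factor, ?_⟩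
  rw [← factor, ← Matrix.conjTranspose_eq_transpose_of_trivial]
  exact Matrix.posSemidef_conjTranspose_mul_self _
end

section
/- Let μ be a Borel probability measure on ℝ, symmetric under x ↦ −x, with ∫x²dμ = 1 and r(t) := ∫e^{t x²}dμ(x) < ∞ for every t > 0, and let φ(t) := log∫e^{t x}dμ(x). Let u : ℝ → ℝ be even, infinitely differentiable, convex, with u ≥ 0, u(0) = 0, u''(0) > 0, and u(x) ≤ u''(0)x²/2 for all x ∈ ℝ. Fix β ≥ 0 and h ∈ ℝ. Then the limit A(β,h) := lim_{N→∞} A_N(β,h) exists, equals inf_{N≥1} A_N(β,h), and is given by the variational formula A(β,h) = sup_{M∈ℝ} [ β(u(M) − M·u'(M)) + φ(β u'(M) + h) ]. -/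
open MeasureTheory Filter

/-- A differentiable convex function lies above its tangent lines. -/
lemma ConvexOn.tangent_line_le {u : ℝ → ℝ} (hu : ConvexOn ℝ Set.univ u)
    (hd : Differentiable ℝ u) (M x : ℝ) : u M + deriv u M * (x - M) ≤ u x := by
  rcases lt_trichotomy M x with hx | rfl | hx
  · have := hu.deriv_le_slope (Set.mem_univ M) (Set.mem_univ x) hx (hd M)
    rw [slope_def_field, le_div_iff₀ (sub_pos.2 hx)] at this
    linarith
  · simp
  · have := hu.slope_le_deriv (Set.mem_univ x) (Set.mem_univ M) hx (hd M)
    rw [slope_def_field, div_le_iff₀ (sub_pos.2 hx)] at this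
    linarith

/-- On a bounded interval a differentiable function is approximated from above, up to `ε`,
by the maximum of finitely many of its tangent lines. -/
lemma exists_finset_tangent_line_add {u : ℝ → ℝ} (hd : Differentiable ℝ u) (R : ℝ) {ε : ℝ}
    (hε : 0 < ε) :
    ∃ s : Finset ℝ, ∀ x, |x| ≤ R → ∃ M ∈ s, u x ≤ u M + deriv u M * (x - M) + ε := by
  obtain ⟨s, -, hs⟩ := (isCompact_Icc (a := -R) (b := R)).elim_nhds_subcover
    (fun M => {x | u x < u M + deriv u M * (x - M) + ε}) fun M _ => by
      refine (isOpen_lt hd.continuous (by fun_prop)).mem_nhds ?_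
      simpa using hε
  refine ⟨s, fun x hx => ?_⟩
  obtain ⟨M, hM, hxM⟩ := Set.mem_iUnion₂.1 (hs (abs_le.1 hx))
  exact ⟨M, hM, le_of_lt hxM⟩

lemma integrable_exp_quadratic {μ : Measure ℝ} [IsProbabilityMeasure μ]
    (hr : ∀ t : ℝ, 0 < t → Integrable (fun x => Real.exp (t * x ^ 2)) μ) {b : ℝ} (hb : 0 ≤ b)
    (t : ℝ) : Integrable (fun x => Real.exp (b * x ^ 2 + t * x)) μ := by
  refine ((hr (b + 1) (by linarith)).const_mul (Real.exp (t ^ 2))).mono'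
    (by fun_prop) (ae_of_all _ fun x => ?_)
  rw [Real.norm_of_nonneg (Real.exp_pos _).le, ← Real.exp_add]
  refine Real.exp_le_exp.2 ?_
  nlinarith [sq_nonneg (x - t), sq_nonneg x, sq_nonneg t]

lemma integrable_exp_linear {μ : Measure ℝ} [IsProbabilityMeasure μ]
    (hr : ∀ t : ℝ, 0 < t → Integrable (fun x => Real.exp (t * x ^ 2)) μ) (t : ℝ) :
    Integrable (fun x => Real.exp (t * x)) μ := by
  simpa using integrable_exp_quadratic hr le_rfl t

lemma integrable_pi_exp_sum {μ : Measure ℝ} [SigmaFinite μ] {f : ℝ → ℝ}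
    (hf : Integrable (fun x => Real.exp (f x)) μ) (N : ℕ) :
    Integrable (fun σ : Fin N → ℝ => Real.exp (∑ i, f (σ i))) (Measure.pi fun _ => μ) := by
  simp_rw [Real.exp_sum]
  exact Integrable.fintype_prod (f := fun _ x => Real.exp (f x)) fun _ => hf

lemma integral_pi_exp_sum {μ : Measure ℝ} [SigmaFinite μ] (f : ℝ → ℝ) (N : ℕ) :
    ∫ σ : Fin N → ℝ, Real.exp (∑ i, f (σ i)) ∂(Measure.pi fun _ => μ)
      = (∫ x, Real.exp (f x) ∂μ) ^ N := by
  simp_rw [Real.exp_sum]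
  simpa using integral_fintype_prod_eq_pow (ι := Fin N) (μ := μ) (fun x => Real.exp (f x))

lemma natCast_mul_sq_mean_le {N : ℕ} (hN : N ≠ 0) (σ : Fin N → ℝ) :
    (N : ℝ) * ((∑ i, σ i) / N) ^ 2 ≤ ∑ i, σ i ^ 2 := by
  have h := sq_sum_le_card_mul_sum_sq (s := Finset.univ) (f := σ)
  rw [Finset.card_univ, Fintype.card_fin] at h
  have hN' : (0 : ℝ) < N := by positivity
  rw [div_pow, show (N : ℝ) * ((∑ i, σ i) ^ 2 / (N : ℝ) ^ 2) = (∑ i, σ i) ^ 2 / N by field_simp,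
    div_le_iff₀ hN']
  linarith

section MeanField

variable {μ : Measure ℝ} [IsProbabilityMeasure μ] {u : ℝ → ℝ} {β h c : ℝ}

/-- The partition function of the mean-field ferromagnet with `N` spins. -/
noncomputable def partitionFn (μ : Measure ℝ) (u : ℝ → ℝ) (β h : ℝ) (N : ℕ) : ℝ :=
  ∫ σ : Fin N → ℝ,
    Real.exp ((N : ℝ) * β * u ((∑ i, σ i) / N) + (N : ℝ) * h * ((∑ i, σ i) / N))
      ∂(Measure.pi fun _ => μ)

/-- The trial pressure at the trial magnetisation `M`. -/
noncomputable def trialPressure (μ : Measure ℝ) (u : ℝ → ℝ) (β h M : ℝ) : ℝ :=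
  β * (u M - M * deriv u M) + Real.log (∫ x, Real.exp ((β * deriv u M + h) * x) ∂μ)

lemma integral_pi_exp_tangent_line
    (hr : ∀ t : ℝ, 0 < t → Integrable (fun x => Real.exp (t * x ^ 2)) μ) {N : ℕ} (hN : N ≠ 0)
    (M : ℝ) :
    Integrable (fun σ : Fin N → ℝ => Real.exp ((N : ℝ) * β *
      (u M + deriv u M * ((∑ i, σ i) / N - M)) + (N : ℝ) * h * ((∑ i, σ i) / N)))
      (Measure.pi fun _ => μ) ∧
    ∫ σ : Fin N → ℝ, Real.exp ((N : ℝ) * β *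
      (u M + deriv u M * ((∑ i, σ i) / N - M)) + (N : ℝ) * h * ((∑ i, σ i) / N))
      ∂(Measure.pi fun _ => μ) = Real.exp (N * trialPressure μ u β h M) := by
  have hN' : (N : ℝ) ≠ 0 := by exact_mod_cast hN
  have key : ∀ σ : Fin N → ℝ, Real.exp ((N : ℝ) * β *
      (u M + deriv u M * ((∑ i, σ i) / N - M)) + (N : ℝ) * h * ((∑ i, σ i) / N))
      = Real.exp (N * (β * (u M - M * deriv u M)))
        * Real.exp (∑ i, (β * deriv u M + h) * σ i) := by
    intro σ
    rw [← Real.exp_add, ← Finset.mul_sum]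
    congr 1
    field_simp
    ring
  simp_rw [key]
  have hint := integrable_exp_linear hr (β * deriv u M + h)
  refine ⟨(integrable_pi_exp_sum hint N).const_mul _, ?_⟩
  rw [integral_const_mul, integral_pi_exp_sum (fun x => (β * deriv u M + h) * x), trialPressure,
    mul_add, Real.exp_add, Real.exp_nat_mul (Real.log _), Real.exp_log (integral_exp_pos hint)]

lemma partitionFn_exponent_le (hub : ∀ x, u x ≤ c * x ^ 2 / 2) (hβ : 0 ≤ β) (hc : 0 ≤ c)
    {N : ℕ} (hN : N ≠ 0) (σ : Fin N → ℝ) :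
    (N : ℝ) * β * u ((∑ i, σ i) / N) + (N : ℝ) * h * ((∑ i, σ i) / N)
      ≤ ∑ i, (β * c / 2 * σ i ^ 2 + h * σ i) := by
  have h1 := natCast_mul_sq_mean_le hN σ
  have hN' : (N : ℝ) ≠ 0 := by exact_mod_cast hN
  rw [Finset.sum_add_distrib, ← Finset.mul_sum, ← Finset.mul_sum]
  have h2 : (N : ℝ) * h * ((∑ i, σ i) / N) = h * ∑ i, σ i := by field_simp
  rw [h2]
  refine add_le_add_left ?_ _
  calc (N : ℝ) * β * u ((∑ i, σ i) / N)
      ≤ N * β * (c * ((∑ i, σ i) / N) ^ 2 / 2) := by gcongr; exact hub _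
    _ = β * c / 2 * (N * ((∑ i, σ i) / N) ^ 2) := by ring
    _ ≤ _ := by gcongr

lemma integrable_partitionFn
    (hr : ∀ t : ℝ, 0 < t → Integrable (fun x => Real.exp (t * x ^ 2)) μ)
    (hcont : Continuous u) (hub : ∀ x, u x ≤ c * x ^ 2 / 2) (hβ : 0 ≤ β) (hc : 0 ≤ c)
    {N : ℕ} (hN : N ≠ 0) :
    Integrable (fun σ : Fin N → ℝ => Real.exp ((N : ℝ) * β * u ((∑ i, σ i) / N)
      + (N : ℝ) * h * ((∑ i, σ i) / N))) (Measure.pi fun _ => μ) := by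
  refine (integrable_pi_exp_sum
    (integrable_exp_quadratic hr (b := β * c / 2) (by positivity) h) N).mono'
    (Continuous.aestronglyMeasurable (by fun_prop)) (ae_of_all _ fun σ => ?_)
  rw [Real.norm_of_nonneg (Real.exp_pos _).le]
  exact Real.exp_le_exp.2 (partitionFn_exponent_le hub hβ hc hN σ)

lemma exp_trialPressure_le_partitionFn
    (hr : ∀ t : ℝ, 0 < t → Integrable (fun x => Real.exp (t * x ^ 2)) μ)
    (hconv : ConvexOn ℝ Set.univ u) (hd : Differentiable ℝ u)
    (hub : ∀ x, u x ≤ c * x ^ 2 / 2) (hβ : 0 ≤ β) (hc : 0 ≤ c)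
    {N : ℕ} (hN : N ≠ 0) (M : ℝ) :
    Real.exp (N * trialPressure μ u β h M) ≤ partitionFn μ u β h N := by
  obtain ⟨hint, heq⟩ := integral_pi_exp_tangent_line (u := u) (β := β) (h := h) hr hN M
  rw [← heq, partitionFn]
  refine integral_mono hint (integrable_partitionFn hr hd.continuous hub hβ hc hN) fun σ => ?_
  dsimp only
  gcongr
  exact hconv.tangent_line_le hd M _

lemma exists_partitionFn_le
    (hr : ∀ t : ℝ, 0 < t → Integrable (fun x => Real.exp (t * x ^ 2)) μ)
    (hd : Differentiable ℝ u) (hub : ∀ x, u x ≤ c * x ^ 2 / 2) (hβ : 0 ≤ β) (hc : 0 ≤ c)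
    {S : ℝ} (hS : ∀ M, trialPressure μ u β h M ≤ S) {ε : ℝ} (hε : 0 < ε) :
    ∃ K : ℕ, ∀ N : ℕ, N ≠ 0 →
      partitionFn μ u β h N ≤ (K + 1) * Real.exp (N * (β * ε + S)) := by
  have hCint := integrable_exp_quadratic hr (b := β * c / 2 + 1) (by positivity) h
  set C := ∫ x, Real.exp ((β * c / 2 + 1) * x ^ 2 + h * x) ∂μ with hC
  have hCpos : 0 < C := integral_exp_pos hCint
  set R := |Real.log C - S| + 1 with hR
  have hCR : C ≤ Real.exp (R ^ 2 + S) := by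
    rw [← Real.log_le_iff_le_exp hCpos]
    nlinarith [le_abs_self (Real.log C - S), abs_nonneg (Real.log C - S)]
  obtain ⟨s, hs⟩ := exists_finset_tangent_line_add hd R hε
  refine ⟨s.card, fun N hN => ?_⟩
  have hN0 : (0 : ℝ) < N := by positivity
  let T : ℝ → (Fin N → ℝ) → ℝ := fun M σ => Real.exp ((N : ℝ) * β *
      (u M + deriv u M * ((∑ i, σ i) / N - M)) + (N : ℝ) * h * ((∑ i, σ i) / N))
  let Q : (Fin N → ℝ) → ℝ := fun σ =>
    Real.exp (∑ i, ((β * c / 2 + 1) * σ i ^ 2 + h * σ i))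
  have hT : ∀ M, Integrable (T M) (Measure.pi fun _ => μ) := fun M =>
    (integral_pi_exp_tangent_line hr hN M).1
  have hQ : Integrable Q (Measure.pi fun _ => μ) := integrable_pi_exp_sum hCint N
  have hTs : Integrable (fun σ => ∑ M ∈ s, Real.exp (N * (β * ε)) * T M σ)
      (Measure.pi fun _ => μ) := integrable_finsetSum _ fun M _ => (hT M).const_mul _
  have hpt : ∀ σ : Fin N → ℝ,
      Real.exp ((N : ℝ) * β * u ((∑ i, σ i) / N) + (N : ℝ) * h * ((∑ i, σ i) / N))
        ≤ ∑ M ∈ s, Real.exp (N * (β * ε)) * T M σ + Real.exp (-(N * R ^ 2)) * Q σ := by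
    intro σ
    rcases le_or_gt |(∑ i, σ i) / N| R with hm | hm
    · obtain ⟨M, hM, hle⟩ := hs _ hm
      have h1 : Real.exp (N * (β * ε)) * T M σ ≤ ∑ M ∈ s, Real.exp (N * (β * ε)) * T M σ :=
        Finset.single_le_sum (f := fun M => Real.exp (N * (β * ε)) * T M σ)
          (fun _ _ => by positivity) hM
      have h2 : Real.exp ((N : ℝ) * β * u ((∑ i, σ i) / N) + (N : ℝ) * h * ((∑ i, σ i) / N))
          ≤ Real.exp (N * (β * ε)) * T M σ := by
        rw [← Real.exp_add]
        refine Real.exp_le_exp.2 ?_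
        have := mul_le_mul_of_nonneg_left hle (mul_nonneg hN0.le hβ)
        linarith
      have h3 : 0 ≤ Real.exp (-(N * R ^ 2)) * Q σ := by positivity
      linarith
    · have h1 : 0 ≤ ∑ M ∈ s, Real.exp (N * (β * ε)) * T M σ :=
        Finset.sum_nonneg fun _ _ => by positivity
      refine le_add_of_nonneg_of_le h1 ?_
      rw [← Real.exp_add]
      refine Real.exp_le_exp.2 ?_
      have h2 := partitionFn_exponent_le (h := h) hub hβ hc hN σ
      have h3 := natCast_mul_sq_mean_le hN σ
      have h4 : R ^ 2 ≤ ((∑ i, σ i) / N) ^ 2 :=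
        sq_le_sq.2 (by rw [abs_of_nonneg (by positivity : 0 ≤ R)]; exact hm.le)
      have h5 := mul_le_mul_of_nonneg_left h4 hN0.le
      have h6 : ∑ i, ((β * c / 2 + 1) * σ i ^ 2 + h * σ i)
          = ∑ i, (β * c / 2 * σ i ^ 2 + h * σ i) + ∑ i, σ i ^ 2 := by
        rw [← Finset.sum_add_distrib]
        exact Finset.sum_congr rfl fun i _ => by ring
      linarith
  have hTle : ∀ M ∈ s, Real.exp (N * (β * ε)) * ∫ σ, T M σ ∂(Measure.pi fun _ => μ)
      ≤ Real.exp (N * (β * ε + S)) := by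
    intro M _
    rw [(integral_pi_exp_tangent_line hr hN M).2, ← Real.exp_add, ← mul_add]
    gcongr
    exact hS M
  have hQle : Real.exp (-(N * R ^ 2)) * ∫ σ, Q σ ∂(Measure.pi fun _ => μ)
      ≤ Real.exp (N * (β * ε + S)) := by
    rw [integral_pi_exp_sum (fun x => (β * c / 2 + 1) * x ^ 2 + h * x), ← hC]
    calc Real.exp (-(N * R ^ 2)) * C ^ N
        ≤ Real.exp (-(N * R ^ 2)) * Real.exp (R ^ 2 + S) ^ N := by gcongr
      _ = Real.exp (N * S) := by rw [← Real.exp_nat_mul, ← Real.exp_add]; congr 1; ring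
      _ ≤ _ := by gcongr; exact le_add_of_nonneg_left (by positivity)
  calc partitionFn μ u β h N
      ≤ ∫ σ, (∑ M ∈ s, Real.exp (N * (β * ε)) * T M σ + Real.exp (-(N * R ^ 2)) * Q σ)
          ∂(Measure.pi fun _ => μ) :=
        integral_mono_of_nonneg (ae_of_all _ fun _ => (Real.exp_pos _).le)
          (hTs.add (hQ.const_mul _)) (ae_of_all _ hpt)
    _ = ∑ M ∈ s, Real.exp (N * (β * ε)) * ∫ σ, T M σ ∂(Measure.pi fun _ => μ)
          + Real.exp (-(N * R ^ 2)) * ∫ σ, Q σ ∂(Measure.pi fun _ => μ) := by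
        rw [integral_add hTs (hQ.const_mul _), integral_const_mul,
          integral_finsetSum _ fun M _ => (hT M).const_mul _]
        simp_rw [integral_const_mul]
    _ ≤ (s.card + 1) * Real.exp (N * (β * ε + S)) := by
        have := Finset.sum_le_card_nsmul s _ _ hTle
        rw [nsmul_eq_mul] at this
        linarith

end MeanField

theorem stmt_5 (μ : Measure ℝ) [IsProbabilityMeasure μ]
    (hsymm : μ.map (fun x => -x) = μ)
    (hvar : ∫ x, x ^ 2 ∂μ = 1)
    (hr : ∀ t : ℝ, 0 < t → Integrable (fun x => Real.exp (t * x ^ 2)) μ)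
    (φ : ℝ → ℝ) (hφ : ∀ t, φ t = Real.log (∫ x, Real.exp (t * x) ∂μ))
    (u : ℝ → ℝ) (hu_even : ∀ x, u (-x) = u x)
    (hu_smooth : ContDiff ℝ (⊤ : ℕ∞) u) (hu_conv : ConvexOn ℝ Set.univ u)
    (hu_nonneg : ∀ x, 0 ≤ u x) (hu0 : u 0 = 0)
    (hu2 : 0 < iteratedDeriv 2 u 0)
    (hub : ∀ x, u x ≤ iteratedDeriv 2 u 0 * x ^ 2 / 2)
    (β h : ℝ) (hβ : 0 ≤ β)
    (A : ℕ → ℝ)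
    (hA : ∀ N : ℕ, A N = (N : ℝ)⁻¹ * Real.log (∫ σ : Fin N → ℝ,
        Real.exp ((N : ℝ) * β * u ((∑ i, σ i) / N) + (N : ℝ) * h * ((∑ i, σ i) / N))
        ∂(Measure.pi fun _ => μ))) :
    Tendsto (fun N : ℕ => A N) atTop (nhds (⨅ N : ℕ+, A N)) ∧
    (⨅ N : ℕ+, A N) =
      ⨆ M : ℝ, (β * (u M - M * deriv u M) + φ (β * deriv u M + h)) := by
  have hd : Differentiable ℝ u := hu_smooth.differentiable (by simp)
  have hφ' : ∀ M, β * (u M - M * deriv u M) + φ (β * deriv u M + h)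
      = trialPressure μ u β h M := fun M => by rw [hφ, trialPressure]
  have hA' : ∀ N, A N = (N : ℝ)⁻¹ * Real.log (partitionFn μ u β h N) := hA
  simp_rw [hφ']
  have hlow : ∀ N : ℕ, N ≠ 0 → ∀ M, trialPressure μ u β h M ≤ A N := by
    intro N hN M
    have hN0 : (0 : ℝ) < N := by positivity
    rw [hA', ← div_eq_inv_mul, le_div_iff₀' hN0, ← Real.log_exp (N * _)]
    exact Real.log_le_log (Real.exp_pos _)
      (exp_trialPressure_le_partitionFn hr hu_conv hd hub hβ hu2.le hN M)
  set S := ⨆ M, trialPressure μ u β h M with hS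
  have hbdd : BddAbove (Set.range (trialPressure μ u β h)) :=
    ⟨A 1, Set.forall_mem_range.2 (hlow 1 one_ne_zero)⟩
  have hSA : ∀ N : ℕ, N ≠ 0 → S ≤ A N := fun N hN => ciSup_le (hlow N hN)
  have hlim : Tendsto A atTop (nhds S) := by
    refine tendsto_order.2 ⟨fun a ha => ?_, fun a ha => ?_⟩
    · filter_upwards [eventually_ne_atTop 0] with N hN using ha.trans_le (hSA N hN)
    obtain ⟨ε, hε, hεa⟩ : ∃ ε, 0 < ε ∧ β * ε + S < a := by
      refine ⟨(a - S) / (β + 1), div_pos (sub_pos.2 ha) (by positivity), ?_⟩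
      rw [← lt_sub_iff_add_lt, ← mul_div_assoc, div_lt_iff₀ (by positivity)]
      nlinarith
    obtain ⟨K, hK⟩ := exists_partitionFn_le hr hd hub hβ hu2.le (le_ciSup hbdd) hε
    have hconst : Tendsto (fun N : ℕ => (N : ℝ)⁻¹ * Real.log (K + 1) + (β * ε + S)) atTop
        (nhds (0 * Real.log (K + 1) + (β * ε + S))) :=
      (tendsto_inv_atTop_nhds_zero_nat.mul_const _).add_const _
    rw [zero_mul, zero_add] at hconst
    filter_upwards [hconst.eventually_lt_const hεa, eventually_ne_atTop 0] with N hNa hN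
    have hN0 : (0 : ℝ) < N := by positivity
    refine lt_of_le_of_lt ?_ hNa
    have hpos : 0 < partitionFn μ u β h N := (Real.exp_pos _).trans_le
      (exp_trialPressure_le_partitionFn hr hu_conv hd hub hβ hu2.le hN 0)
    have := Real.log_le_log hpos (hK N hN)
    rw [Real.log_mul (by positivity) (Real.exp_ne_zero _), Real.log_exp] at this
    rw [hA', inv_mul_le_iff₀ hN0, mul_add, mul_inv_cancel_left₀ hN0.ne']
    exact this
  have hinf : (⨅ N : ℕ+, A N) = S := by
    refine le_antisymm (ge_of_tendsto hlim ?_) (le_ciInf fun N => hSA N N.ne_zero)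
    filter_upwards [eventually_gt_atTop 0] with N hN
    exact ciInf_le (f := fun N : ℕ+ => A N)
      ⟨S, Set.forall_mem_range.2 fun N => hSA N N.ne_zero⟩ ⟨N, hN⟩
  exact ⟨hinf ▸ hlim, hinf⟩
end

section
/- Let μ be a Borel probability measure on ℝ such that Z_N(β,h) := E[exp(Nβu(m_N) + N h m_N)] is finite, where σ₁,…,σ_N are i.i.d. with law μ and m_N := N⁻¹Σᵢσᵢ, and let u : ℝ → ℝ be convex. Then for all β ≥ 0, h ∈ ℝ and all positive integers N₁, N₂: Z_{N₁+N₂}(β,h) ≤ Z_{N₁}(β,h)·Z_{N₂}(β,h); equivalently (N₁+N₂)·A_{N₁+N₂}(β,h) ≤ N₁·A_{N₁}(β,h) + N₂·A_{N₂}(β,h) for the pressures A_N := N⁻¹ log Z_N. -/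
open MeasureTheory

/-- Concatenation of vectors carries the product of two power measures to a power measure. -/
theorem measurePreserving_finAppend {α : Type*} [MeasurableSpace α] (μ : Measure α)
    [SigmaFinite μ] (m n : ℕ) :
    MeasurePreserving (fun p : (Fin m → α) × (Fin n → α) => Fin.append p.1 p.2)
      ((Measure.pi fun _ => μ).prod (Measure.pi fun _ => μ)) (Measure.pi fun _ => μ) := by
  have hsum := measurePreserving_sumPiEquivProdPi_symm (fun _ : Fin m ⊕ Fin n => μ)
  have hcongr := measurePreserving_piCongrLeft (fun _ : Fin (m + n) => μ) finSumFinEquiv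
  convert hcongr.comp hsum using 1
  ext p i
  refine Fin.addCases (fun j => ?_) (fun j => ?_) i
  · have := MeasurableEquiv.piCongrLeft_apply_apply (β := fun _ : Fin (m + n) => α) finSumFinEquiv
      ((MeasurableEquiv.sumPiEquivProdPi fun _ : Fin m ⊕ Fin n => α).symm p) (Sum.inl j)
    rw [finSumFinEquiv_apply_left] at this
    rw [Fin.append_left]
    exact this.symm
  · have := MeasurableEquiv.piCongrLeft_apply_apply (β := fun _ : Fin (m + n) => α) finSumFinEquiv
      ((MeasurableEquiv.sumPiEquivProdPi fun _ : Fin m ⊕ Fin n => α).symm p) (Sum.inr j)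
    rw [finSumFinEquiv_apply_right] at this
    rw [Fin.append_right]
    exact this.symm

/-- The perspective `(x, a) ↦ a * u (x / a)` of a convex function is subadditive. -/
theorem ConvexOn.perspective_add_le {u : ℝ → ℝ} (hu : ConvexOn ℝ Set.univ u) {a b : ℝ}
    (ha : 0 < a) (hb : 0 < b) (x y : ℝ) :
    (a + b) * u ((x + y) / (a + b)) ≤ a * u (x / a) + b * u (y / b) := by
  have hab : 0 < a + b := add_pos ha hb
  have key := hu.2 (Set.mem_univ (x / a)) (Set.mem_univ (y / b))
    (div_nonneg ha.le hab.le) (div_nonneg hb.le hab.le) (by field_simp)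
  simp only [smul_eq_mul] at key
  have harg : a / (a + b) * (x / a) + b / (a + b) * (y / b) = (x + y) / (a + b) := by
    field_simp
  rw [harg] at key
  calc (a + b) * u ((x + y) / (a + b))
      ≤ (a + b) * (a / (a + b) * u (x / a) + b / (a + b) * u (y / b)) := by gcongr
    _ = a * u (x / a) + b * u (y / b) := by field_simp

theorem stmt_6 (μ : Measure ℝ) [IsProbabilityMeasure μ]
    (u : ℝ → ℝ) (hu : ConvexOn ℝ Set.univ u)
    (β h : ℝ) (hβ : 0 ≤ β)
    (hint : ∀ N : ℕ, Integrable (fun σ : Fin N → ℝ =>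
        Real.exp ((N : ℝ) * β * u ((∑ i, σ i) / N) + (N : ℝ) * h * ((∑ i, σ i) / N)))
        (Measure.pi fun _ => μ))
    (Z : ℕ → ℝ)
    (hZ : ∀ N : ℕ, Z N = ∫ σ : Fin N → ℝ,
        Real.exp ((N : ℝ) * β * u ((∑ i, σ i) / N) + (N : ℝ) * h * ((∑ i, σ i) / N))
        ∂(Measure.pi fun _ => μ))
    (A : ℕ → ℝ) (hA : ∀ N, A N = (N : ℝ)⁻¹ * Real.log (Z N))
    (N₁ N₂ : ℕ) (h1 : 0 < N₁) (h2 : 0 < N₂) :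
    Z (N₁ + N₂) ≤ Z N₁ * Z N₂ ∧
    ((N₁ + N₂ : ℕ) : ℝ) * A (N₁ + N₂) ≤ (N₁ : ℝ) * A N₁ + (N₂ : ℝ) * A N₂ := by
  have hpos : ∀ N, 0 < Z N := fun N => by
    rw [hZ]
    exact integral_exp_pos (hint N)
  have hmul : Z (N₁ + N₂) ≤ Z N₁ * Z N₂ := by
    have hmp := measurePreserving_finAppend μ N₁ N₂
    rw [hZ (N₁ + N₂), hZ N₁, hZ N₂, ← integral_prod_mul, ← hmp.map_eq,
      integral_map hmp.aemeasurable (by rw [hmp.map_eq]; exact (hint _).aestronglyMeasurable)]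
    refine integral_mono (hmp.integrable_comp_of_integrable (hint _))
      ((hint N₁).mul_prod (hint N₂)) fun p => ?_
    have hN₁ : (0 : ℝ) < N₁ := Nat.cast_pos.2 h1
    have hN₂ : (0 : ℝ) < N₂ := Nat.cast_pos.2 h2
    simp only [← Real.exp_add, Fin.sum_univ_add, Fin.append_left, Fin.append_right, Nat.cast_add]
    refine Real.exp_le_exp.2 ?_
    have hconv := mul_le_mul_of_nonneg_left
      (hu.perspective_add_le hN₁ hN₂ (∑ i, p.1 i) (∑ i, p.2 i)) hβ
    have hfield : ∀ {a : ℝ} (x : ℝ), 0 < a → a * h * (x / a) = h * x := fun x ha => by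
      field_simp
    rw [hfield _ hN₁, hfield _ hN₂, hfield _ (add_pos hN₁ hN₂)]
    linarith
  have hlog : ∀ N : ℕ, 0 < N → (N : ℝ) * A N = Real.log (Z N) := fun N hN => by
    rw [hA, mul_inv_cancel_left₀ (Nat.cast_ne_zero.2 hN.ne')]
  refine ⟨hmul, ?_⟩
  rw [hlog _ (Nat.add_pos_left h1 _), hlog _ h1, hlog _ h2,
    ← Real.log_mul (hpos _).ne' (hpos _).ne']
  exact Real.log_le_log (hpos _) hmul
end

section
/- Let μ be a Borel probability measure on ℝ with φ(t) := log∫e^{t x}dμ(x) finite for all t, let u : ℝ → ℝ be convex and differentiable, and let β ≥ 0, h ∈ ℝ. Then for every N ≥ 1 and every M ∈ ℝ: A_N(β,h) ≥ β(u(M) − M·u'(M)) + φ(β u'(M) + h). -/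
open MeasureTheory

/-- A convex differentiable function on the line lies above its tangent lines. -/
lemma ConvexOn.tangent_line_le_s7 {f : ℝ → ℝ} (hf : ConvexOn ℝ Set.univ f)
    {x : ℝ} (hfx : DifferentiableAt ℝ f x) (y : ℝ) :
    f x + deriv f x * (y - x) ≤ f y := by
  rcases lt_trichotomy x y with h | rfl | h
  · have := hf.deriv_le_slope (Set.mem_univ x) (Set.mem_univ y) h hfx
    rw [slope_def_field, le_div_iff₀ (sub_pos.2 h)] at this
    linarith
  · simp
  · have := hf.slope_le_deriv (Set.mem_univ y) (Set.mem_univ x) h hfx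
    rw [slope_def_field, div_le_iff₀ (sub_pos.2 h)] at this
    linarith

/-- Exponential moments of a sum of independent variables factorize. -/
lemma lintegral_pi_ofReal_exp_affine {ι : Type*} [Fintype ι] (μ : Measure ℝ) [SigmaFinite μ]
    (a c : ℝ) (hc : Integrable (fun x => Real.exp (c * x)) μ) :
    ∫⁻ σ : ι → ℝ, ENNReal.ofReal (Real.exp (a + c * ∑ i, σ i)) ∂(Measure.pi fun _ => μ) =
      ENNReal.ofReal (Real.exp a * (∫ x, Real.exp (c * x) ∂μ) ^ Fintype.card ι) := by
  have hexp (σ : ι → ℝ) :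
      Real.exp (a + c * ∑ i, σ i) = Real.exp a * ∏ i, Real.exp (c * σ i) := by
    rw [Real.exp_add, Finset.mul_sum, Real.exp_sum]
  simp_rw [hexp]
  rw [← ofReal_integral_eq_lintegral_ofReal
    ((Integrable.fintype_prod (f := fun _ x => Real.exp (c * x)) fun _ => hc).const_mul _)
    (.of_forall fun σ => by positivity), integral_const_mul,
    integral_fintype_prod_eq_pow (fun x => Real.exp (c * x))]

theorem stmt_7 (μ : Measure ℝ) [IsProbabilityMeasure μ]
    (hφint : ∀ t : ℝ, Integrable (fun x => Real.exp (t * x)) μ)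
    (φ : ℝ → ℝ) (hφ : ∀ t, φ t = Real.log (∫ x, Real.exp (t * x) ∂μ))
    (u : ℝ → ℝ) (hconv : ConvexOn ℝ Set.univ u) (hdiff : Differentiable ℝ u)
    (β h : ℝ) (hβ : 0 ≤ β) (N : ℕ) (hN : 1 ≤ N) (M : ℝ) :
    ((β * (u M - M * deriv u M) + φ (β * deriv u M + h) : ℝ) : EReal) ≤
      (((N : ℝ)⁻¹ : ℝ) : EReal) * ENNReal.log (∫⁻ σ : Fin N → ℝ,
        ENNReal.ofReal (Real.exp ((N : ℝ) * β * u ((∑ i, σ i) / N) +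
          (N : ℝ) * h * ((∑ i, σ i) / N)))
        ∂(Measure.pi fun _ => μ)) := by
  have hN0 : (0 : ℝ) < N := by exact_mod_cast hN
  set a := β * (u M - M * deriv u M)
  set c := β * deriv u M + h with hc
  have hpos : 0 < ∫ x, Real.exp (c * x) ∂μ := integral_exp_pos (hφint c)
  have htrial : ∫⁻ σ : Fin N → ℝ, ENNReal.ofReal (Real.exp (N * a + c * ∑ i, σ i))
        ∂(Measure.pi fun _ => μ) ≤
      ∫⁻ σ : Fin N → ℝ, ENNReal.ofReal (Real.exp ((N : ℝ) * β * u ((∑ i, σ i) / N) +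
          (N : ℝ) * h * ((∑ i, σ i) / N))) ∂(Measure.pi fun _ => μ) := by
    refine lintegral_mono fun σ => ENNReal.ofReal_le_ofReal (Real.exp_le_exp.2 ?_)
    set m := (∑ i, σ i) / N with hm
    have hsum : ∑ i, σ i = N * m := by rw [hm]; field_simp
    have := mul_le_mul_of_nonneg_left (hconv.tangent_line_le_s7 (hdiff M) m)
      (mul_nonneg hN0.le hβ)
    rw [hsum]
    calc (N : ℝ) * a + c * (N * m)
        = N * β * (u M + deriv u M * (m - M)) + N * h * m := by simp only [a, hc]; ring
      _ ≤ _ := by gcongr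
  rw [lintegral_pi_ofReal_exp_affine μ _ _ (hφint c), Fintype.card_fin] at htrial
  refine le_trans (le_of_eq ?_) (mul_le_mul_of_nonneg_left (ENNReal.log_le_log htrial)
    (EReal.coe_nonneg.2 (inv_nonneg.2 hN0.le)))
  rw [ENNReal.log_ofReal_of_pos (by positivity), ← EReal.coe_mul, EReal.coe_eq_coe_iff,
    Real.log_mul (Real.exp_ne_zero _) (pow_ne_zero _ hpos.ne'), Real.log_exp, Real.log_pow, hφ]
  field_simp
end

section
/- Let μ be a Borel probability measure on ℝ with r(t) := ∫e^{t x²}dμ(x) < ∞ for every t > 0, and let u : ℝ → ℝ be even, twice differentiable, convex, with u(0) = 0 and u(x) ≤ u''(0)x²/2 for all x. Let σ₁,…,σ_N be i.i.d. with law μ and m_N := N⁻¹Σᵢσᵢ. Then for every β ≥ 0, h ≥ 0 and M̄ > 0: E[ 1{m_N ≥ M̄} · exp(Nβu(m_N) + N h m_N) ] ≤ e^{N(h²/4 − M̄²)} · r(βu''(0)+2)^N. -/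
open MeasureTheory

theorem lintegral_exp_mul_sum_sq_pi (μ : Measure ℝ) [IsProbabilityMeasure μ] (N : ℕ) (t : ℝ)
    (ht : Integrable (fun x => Real.exp (t * x ^ 2)) μ) (a : ℝ) :
    ∫⁻ σ : Fin N → ℝ, ENNReal.ofReal (Real.exp (a + t * ∑ i, σ i ^ 2)) ∂(Measure.pi fun _ => μ) =
      ENNReal.ofReal (Real.exp a * (∫ x, Real.exp (t * x ^ 2) ∂μ) ^ N) := by
  have hprod (σ : Fin N → ℝ) :
      Real.exp (a + t * ∑ i, σ i ^ 2) = Real.exp a * ∏ i, Real.exp (t * σ i ^ 2) := by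
    rw [Real.exp_add, Finset.mul_sum, Real.exp_sum]
  simp_rw [hprod]
  rw [← ofReal_integral_eq_lintegral_ofReal, integral_const_mul,
    integral_fintype_prod_eq_pow (fun x => Real.exp (t * x ^ 2)), Fintype.card_fin]
  · exact (Integrable.fintype_prod (f := fun _ x => Real.exp (t * x ^ 2)) fun _ => ht).const_mul _
  · exact Filter.Eventually.of_forall fun σ => by positivity

theorem convexOn_nonneg_of_even {u : ℝ → ℝ} (hu : ConvexOn ℝ Set.univ u)
    (heven : ∀ x, u (-x) = u x) (h0 : u 0 = 0) (x : ℝ) : 0 ≤ u x := by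
  have h := hu.2 (Set.mem_univ x) (Set.mem_univ (-x))
    (by norm_num : (0 : ℝ) ≤ 1 / 2) (by norm_num : (0 : ℝ) ≤ 1 / 2) (by norm_num)
  simp only [smul_eq_mul, heven] at h
  rw [show (1 / 2 : ℝ) * x + 1 / 2 * -x = 0 by ring, h0] at h
  linarith

theorem card_mul_mean_sq_le_sum_sq {N : ℕ} (hN : 0 < N) (σ : Fin N → ℝ) :
    (N : ℝ) * ((∑ i, σ i) / N) ^ 2 ≤ ∑ i, σ i ^ 2 := by
  have hN' : (0 : ℝ) < N := Nat.cast_pos.mpr hN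
  have h := sq_sum_le_card_mul_sum_sq (s := Finset.univ) (f := σ)
  rw [Finset.card_univ, Fintype.card_fin] at h
  calc (N : ℝ) * ((∑ i, σ i) / N) ^ 2 = (∑ i, σ i) ^ 2 / N := by field_simp
    _ ≤ ∑ i, σ i ^ 2 := by rwa [div_le_iff₀ hN', mul_comm]

open MeasureTheory

theorem stmt_9 (μ : Measure ℝ) [IsProbabilityMeasure μ]
    (hr : ∀ t : ℝ, 0 < t → Integrable (fun x => Real.exp (t * x ^ 2)) μ)
    (r : ℝ → ℝ) (hrdef : ∀ t, r t = ∫ x, Real.exp (t * x ^ 2) ∂μ)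
    (u : ℝ → ℝ) (hu_even : ∀ x, u (-x) = u x)
    (hu_diff : Differentiable ℝ u) (hu_diff2 : Differentiable ℝ (deriv u))
    (hu_conv : ConvexOn ℝ Set.univ u) (hu0 : u 0 = 0)
    (hub : ∀ x, u x ≤ iteratedDeriv 2 u 0 * x ^ 2 / 2)
    (N : ℕ) (hN : 0 < N) (β h Mbar : ℝ) (hβ : 0 ≤ β) (hh : 0 ≤ h) (hM : 0 < Mbar) :
    ∫⁻ σ in {σ : Fin N → ℝ | Mbar ≤ (∑ i, σ i) / N},
        ENNReal.ofReal (Real.exp ((N : ℝ) * β * u ((∑ i, σ i) / N) +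
          (N : ℝ) * h * ((∑ i, σ i) / N)))
      ∂(Measure.pi fun _ => μ)
    ≤ ENNReal.ofReal (Real.exp ((N : ℝ) * (h ^ 2 / 4 - Mbar ^ 2)) *
        r (β * iteratedDeriv 2 u 0 + 2) ^ N) := by
  set c := iteratedDeriv 2 u 0
  have hc : 0 ≤ c := by
    have h1 := hub 1
    have h2 := convexOn_nonneg_of_even hu_conv hu_even hu0 1
    linarith
  have hβc : 0 ≤ β * c := mul_nonneg hβ hc
  have hT : 0 < β * c + 2 := by linarith
  rw [hrdef, ← lintegral_exp_mul_sum_sq_pi μ N _ (hr _ hT)]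
  refine (setLIntegral_mono' (measurableSet_le measurable_const (by fun_prop)) ?_).trans
    (setLIntegral_le_lintegral _ _)
  intro σ hσ
  rw [Set.mem_ofPred_eq] at hσ
  have hmean := card_mul_mean_sq_le_sum_sq hN σ
  set m := (∑ i, σ i) / N
  have hbound : β * u m + h * m ≤ (h ^ 2 / 4 - Mbar ^ 2) + (β * c + 2) * m ^ 2 := by
    have h1 : β * u m ≤ β * (c * m ^ 2 / 2) := mul_le_mul_of_nonneg_left (hub m) hβ
    have h2 : Mbar ^ 2 ≤ m ^ 2 := pow_le_pow_left₀ hM.le hσ 2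
    have h3 : 0 ≤ β * c * m ^ 2 := mul_nonneg hβc (sq_nonneg m)
    linarith [sq_nonneg (m - h / 2)]
  refine ENNReal.ofReal_le_ofReal (Real.exp_le_exp.mpr ?_)
  calc (N : ℝ) * β * u m + N * h * m = N * (β * u m + h * m) := by ring
    _ ≤ N * ((h ^ 2 / 4 - Mbar ^ 2) + (β * c + 2) * m ^ 2) := by gcongr
    _ = N * (h ^ 2 / 4 - Mbar ^ 2) + (β * c + 2) * (N * m ^ 2) := by ring
    _ ≤ _ := by gcongr
end

section
/- Let u : ℝ → ℝ be differentiable with u'(0) = 0 and u' Lipschitz with constant u''(0) > 0, and let f : ℝ → ℝ be 1-Lipschitz with f(0) = 0. If 0 ≤ β < 1/u''(0), then the equation M = f(β u'(M)) has the unique solution M = 0. -/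
theorem stmt_10 (u : ℝ → ℝ) (hdiff : Differentiable ℝ u)
    (hu'0 : deriv u 0 = 0)
    (hpos : 0 < iteratedDeriv 2 u 0)
    (hlip : LipschitzWith (Real.toNNReal (iteratedDeriv 2 u 0)) (deriv u))
    (f : ℝ → ℝ) (hf : LipschitzWith 1 f) (hf0 : f 0 = 0)
    (β : ℝ) (hβ0 : 0 ≤ β) (hβ : β < 1 / iteratedDeriv 2 u 0) :
    ∀ M : ℝ, M = f (β * deriv u M) ↔ M = 0 := by
  intro M
  constructor
  · intro h
    by_contra hM
    have hβK : β * iteratedDeriv 2 u 0 < 1 := (lt_div_iff₀ hpos).mp hβ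
    have hfM : |f (β * deriv u M)| ≤ β * |deriv u M| := by
      simpa [Real.dist_eq, hf0, abs_mul, abs_of_nonneg hβ0] using
        hf.dist_le_mul (β * deriv u M) 0
    have huM : |deriv u M| ≤ iteratedDeriv 2 u 0 * |M| := by
      have := hlip.dist_le_mul M 0
      rwa [Real.coe_toNNReal _ hpos.le, Real.dist_eq, Real.dist_eq, hu'0, sub_zero,
        sub_zero] at this
    rw [← h] at hfM
    have hMpos : 0 < |M| := abs_pos.mpr hM
    nlinarith [mul_le_mul_of_nonneg_left huM hβ0, mul_lt_mul_of_pos_right hβK hMpos]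
  · rintro rfl
    rw [hu'0, mul_zero, hf0]
end

section
/- Let α ∈ (0,1) and β > 0 satisfy β²α(1−α) > 1. Then the system of equations M₁ = tanh(β(1−α)M₂), M₂ = tanh(βαM₁) admits a solution with M₁ > 0 and M₂ > 0 (and, by oddness of tanh, also the opposite solution (−M₁,−M₂)), in addition to the trivial solution (0,0). -/
theorem hasDerivAt_tanh_zero : HasDerivAt Real.tanh 1 0 := by
  have h := (Real.hasDerivAt_sinh 0).div (Real.hasDerivAt_cosh 0) (Real.cosh_pos 0).ne'
  have e : Real.tanh = Real.sinh / Real.cosh := funext Real.tanh_eq_sinh_div_cosh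
  rw [e]
  simpa using h

theorem continuous_real_tanh : Continuous Real.tanh := by
  have e : Real.tanh = fun x => Real.sinh x / Real.cosh x := funext Real.tanh_eq_sinh_div_cosh
  rw [e]
  exact Real.continuous_sinh.div Real.continuous_cosh fun x => (Real.cosh_pos x).ne'

theorem real_tanh_pos_of_pos {x : ℝ} (hx : 0 < x) : 0 < Real.tanh x := by
  rw [Real.tanh_eq_sinh_div_cosh]
  exact div_pos (Real.sinh_pos_iff.2 hx) (Real.cosh_pos x)

theorem exists_pos_eq_tanh_mul_tanh_mul {a b : ℝ} (hab : 1 < a * b) :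
    ∃ x : ℝ, 0 < x ∧ x = Real.tanh (a * Real.tanh (b * x)) := by
  set f : ℝ → ℝ := fun x => Real.tanh (a * Real.tanh (b * x)) - x with hf
  have hcont : Continuous f := by
    have := continuous_real_tanh
    fun_prop
  have hf0 : f 0 = 0 := by simp [hf]
  have hderiv : HasDerivAt f (a * b - 1) 0 := by
    have h1 : HasDerivAt (fun x : ℝ => b * x) b 0 := by
      simpa using (hasDerivAt_id (0 : ℝ)).const_mul b
    have h2 : HasDerivAt (fun x : ℝ => a * Real.tanh (b * x)) (a * b) 0 := by
      have h := HasDerivAt.comp_of_eq 0 hasDerivAt_tanh_zero h1 (by simp)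
      simpa using h.const_mul a
    have h3 := HasDerivAt.comp_of_eq 0 hasDerivAt_tanh_zero h2 (by simp)
    rw [one_mul] at h3
    exact h3.sub (hasDerivAt_id (0 : ℝ))
  have hslope := (hasDerivAt_iff_tendsto_slope.1 hderiv).mono_left
    (nhdsWithin_mono (0 : ℝ) fun x (hx : x ∈ Set.Ioi (0 : ℝ)) => ne_of_gt hx)
  have hev := hslope.eventually (lt_mem_nhds (sub_pos.2 hab))
  have hev1 : ∀ᶠ x in nhdsWithin (0 : ℝ) (Set.Ioi 0), x ∈ Set.Ioo (0 : ℝ) 1 :=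
    Ioo_mem_nhdsGT one_pos
  obtain ⟨c, hc, hc0, hc1⟩ := (hev.and hev1).exists
  have hfc : 0 < f c := by
    rw [slope_def_field, hf0, sub_zero, sub_zero] at hc
    exact (div_pos_iff_of_pos_right hc0).1 hc
  have hf1 : f 1 ≤ 0 := sub_nonpos.2 (Real.tanh_lt_one _).le
  obtain ⟨x, hx, hfx⟩ := intermediate_value_Icc' hc1.le hcont.continuousOn ⟨hf1, hfc.le⟩
  exact ⟨x, hc0.trans_le hx.1, (sub_eq_zero.1 hfx).symm⟩

theorem stmt_11 (α β : ℝ) (hα : α ∈ Set.Ioo (0 : ℝ) 1) (hβ : 0 < β)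
    (hcrit : 1 < β ^ 2 * α * (1 - α)) :
    ∃ M₁ M₂ : ℝ, 0 < M₁ ∧ 0 < M₂ ∧
      M₁ = Real.tanh (β * (1 - α) * M₂) ∧ M₂ = Real.tanh (β * α * M₁) ∧
      (-M₁ = Real.tanh (β * (1 - α) * (-M₂)) ∧ -M₂ = Real.tanh (β * α * (-M₁))) := by
  obtain ⟨x, hx0, hx⟩ := exists_pos_eq_tanh_mul_tanh_mul (a := β * (1 - α)) (b := β * α)
    (by linarith [show β * (1 - α) * (β * α) = β ^ 2 * α * (1 - α) by ring])
  refine ⟨x, Real.tanh (β * α * x), hx0,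
    real_tanh_pos_of_pos (mul_pos (mul_pos hβ hα.1) hx0), hx, rfl, ?_, ?_⟩
  · rw [mul_neg, Real.tanh_neg, ← hx]
  · rw [mul_neg, Real.tanh_neg]
end

section
/- Let α₁, α₂, α₃ > 0 and define p(β) := 1 − β²(α₁α₂ + α₁α₃ + α₂α₃) − 2β³α₁α₂α₃. Then there exists a unique β_c > 0 with p(β_c) = 0; moreover p(β) > 0 for 0 ≤ β < β_c and p(β) < 0 for β > β_c, and for every 0 ≤ β < β_c all three quantities 1 − β²α₁α₂, 1 − β²α₁α₃, 1 − β²α₂α₃ are strictly positive. -/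
theorem stmt_17 (α₁ α₂ α₃ : ℝ) (h1 : 0 < α₁) (h2 : 0 < α₂) (h3 : 0 < α₃)
    (p : ℝ → ℝ)
    (hp : ∀ β, p β = 1 - β ^ 2 * (α₁ * α₂ + α₁ * α₃ + α₂ * α₃) - 2 * β ^ 3 * α₁ * α₂ * α₃) :
    ∃ βc : ℝ, 0 < βc ∧ p βc = 0 ∧
      (∀ β : ℝ, 0 < β → p β = 0 → β = βc) ∧
      (∀ β : ℝ, 0 ≤ β → β < βc → 0 < p β) ∧
      (∀ β : ℝ, βc < β → p β < 0) ∧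
      (∀ β : ℝ, 0 ≤ β → β < βc →
        0 < 1 - β ^ 2 * α₁ * α₂ ∧ 0 < 1 - β ^ 2 * α₁ * α₃ ∧ 0 < 1 - β ^ 2 * α₂ * α₃) := by
  have h12 := mul_pos h1 h2
  have h123 := mul_pos h12 h3
  have hs : 0 < α₁ * α₂ + α₁ * α₃ + α₂ * α₃ := by positivity
  have anti : StrictAntiOn p (Set.Ici 0) := by
    intro x hx y _ hxy
    have hx0 : 0 ≤ x := hx
    have e2 : x ^ 2 < y ^ 2 := by gcongr
    have e3 : x ^ 3 < y ^ 3 := by gcongr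
    rw [hp, hp]
    linarith [mul_lt_mul_of_pos_right e2 hs, mul_lt_mul_of_pos_right e3 h123]
  have hcont : Continuous p := by
    rw [funext hp]
    fun_prop
  have hp0 : p 0 = 1 := by simp [hp]
  obtain ⟨b, hb, hpb⟩ : ∃ b : ℝ, 0 ≤ b ∧ p b ≤ 0 := by
    set s := α₁ * α₂ + α₁ * α₃ + α₂ * α₃
    refine ⟨1 + 1 / s, by positivity, ?_⟩
    have e : (1 + 1 / s) ^ 2 * s = s + 2 + 1 / s := by
      field_simp
      ring
    have e' : 0 < 1 / s := by positivity
    have e3 : 0 < 2 * (1 + 1 / s) ^ 3 * α₁ * α₂ * α₃ := by positivity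
    rw [hp, e]
    linarith
  obtain ⟨c, ⟨hc0, -⟩, hpc⟩ := intermediate_value_Icc' hb hcont.continuousOn
    (show (0 : ℝ) ∈ Set.Icc (p b) (p 0) from ⟨hpb, by simp [hp0]⟩)
  have hc : 0 < c := by
    rcases hc0.eq_or_lt with rfl | h
    · norm_num [hp0] at hpc
    · exact h
  have hpos : ∀ β : ℝ, 0 ≤ β → β < c → 0 < p β := fun β h h' =>
    hpc ▸ anti h hc0 h'
  refine ⟨c, hc, hpc, fun β h h' => anti.injOn h.le hc0 (h'.trans hpc.symm), hpos,
    fun β h => hpc ▸ anti hc0 (hc0.trans h.le) h, fun β h h' => ?_⟩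
  have hβ := hpos β h h'
  rw [hp] at hβ
  have k12 : 0 ≤ β ^ 2 * α₁ * α₂ := by positivity
  have k13 : 0 ≤ β ^ 2 * α₁ * α₃ := by positivity
  have k23 : 0 ≤ β ^ 2 * α₂ * α₃ := by positivity
  have k123 : 0 ≤ 2 * β ^ 3 * α₁ * α₂ * α₃ := by positivity
  refine ⟨?_, ?_, ?_⟩ <;> linarith
end

section
/- Let N₁, N₂ be positive integers, N := N₁+N₂, α := N₁/N. Let σ¹₁,…,σ¹_{N₁} be i.i.d. real random variables with law μ₁ and, independently, σ²₁,…,σ²_{N₂} i.i.d. with law μ₂, where ∫e^{tx}dμ₂(x) < ∞ for all t ∈ ℝ; set u₁(x) := log∫e^{xs}dμ₂(s), m₁ := N₁⁻¹Σᵢσ¹ᵢ, m₂ := N₂⁻¹Σⱼσ²ⱼ. Then for all β, h₁, h₂ ∈ ℝ (whenever the left-hand side is finite): E[ exp( βNα(1−α)m₁m₂ + βN₁h₁m₁ + βN₂h₂m₂ ) ] = E_{σ¹}[ exp( N₂·u₁(αβm₁ + βh₂) + βN₁h₁m₁ ) ], where E_{σ¹} denotes expectation over the first party's spins only. -/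
open MeasureTheory

/-- The moment generating function of a sum of `n` i.i.d. variables with law `μ` is the exponential
of `n` times the cumulant generating function of `μ`. -/
theorem integral_exp_mul_sum_pi_eq_exp_mul_log {n : ℕ} (μ : Measure ℝ) [IsProbabilityMeasure μ]
    (t : ℝ) (ht : Integrable (fun x => Real.exp (t * x)) μ) :
    ∫ y : Fin n → ℝ, Real.exp (t * ∑ j, y j) ∂(Measure.pi fun _ => μ)
      = Real.exp (n * Real.log (∫ s, Real.exp (t * s) ∂μ)) := by
  simp_rw [Finset.mul_sum, Real.exp_sum]
  rw [integral_fintype_prod_eq_pow (fun x : ℝ => Real.exp (t * x)), Fintype.card_fin,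
    Real.exp_nat_mul, Real.exp_log (integral_exp_pos ht)]

theorem stmt_18 (N₁ N₂ : ℕ) (h1 : 0 < N₁) (h2 : 0 < N₂)
    (μ₁ μ₂ : Measure ℝ) [IsProbabilityMeasure μ₁] [IsProbabilityMeasure μ₂]
    (hμ₂ : ∀ t : ℝ, Integrable (fun x => Real.exp (t * x)) μ₂)
    (u₁ : ℝ → ℝ) (hu₁ : ∀ x, u₁ x = Real.log (∫ s, Real.exp (x * s) ∂μ₂))
    (β h₁ h₂ : ℝ)
    (N : ℕ) (hN : N = N₁ + N₂) (α : ℝ) (hα : α = (N₁ : ℝ) / N)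
    (hint : Integrable (fun σ : (Fin N₁ → ℝ) × (Fin N₂ → ℝ) =>
        Real.exp (β * N * α * (1 - α) * ((∑ i, σ.1 i) / N₁) * ((∑ j, σ.2 j) / N₂)
          + β * N₁ * h₁ * ((∑ i, σ.1 i) / N₁) + β * N₂ * h₂ * ((∑ j, σ.2 j) / N₂)))
        ((Measure.pi fun _ => μ₁).prod (Measure.pi fun _ => μ₂))) :
    ∫ σ : (Fin N₁ → ℝ) × (Fin N₂ → ℝ),
        Real.exp (β * N * α * (1 - α) * ((∑ i, σ.1 i) / N₁) * ((∑ j, σ.2 j) / N₂)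
          + β * N₁ * h₁ * ((∑ i, σ.1 i) / N₁) + β * N₂ * h₂ * ((∑ j, σ.2 j) / N₂))
        ∂((Measure.pi fun _ => μ₁).prod (Measure.pi fun _ => μ₂))
    = ∫ τ : Fin N₁ → ℝ,
        Real.exp ((N₂ : ℝ) * u₁ (α * β * ((∑ i, τ i) / N₁) + β * h₂)
          + β * N₁ * h₁ * ((∑ i, τ i) / N₁))
        ∂(Measure.pi fun _ => μ₁) := by
  have hα' : (N : ℝ) * (1 - α) = N₂ := by
    rw [hα, hN]
    push_cast
    field_simp
    ring
  rw [integral_prod _ hint]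
  refine integral_congr_ae (.of_forall fun τ => ?_)
  have h_factor (y : Fin N₂ → ℝ) :
      Real.exp (β * N * α * (1 - α) * ((∑ i, τ i) / N₁) * ((∑ j, y j) / N₂)
          + β * N₁ * h₁ * ((∑ i, τ i) / N₁) + β * N₂ * h₂ * ((∑ j, y j) / N₂))
        = Real.exp (β * N₁ * h₁ * ((∑ i, τ i) / N₁))
          * Real.exp ((α * β * ((∑ i, τ i) / N₁) + β * h₂) * ∑ j, y j) := by
    have h_coupling : β * N * α * (1 - α) = α * β * N₂ := by
      rw [← hα']
      ring
    rw [← Real.exp_add, h_coupling]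
    congr 1
    field_simp
    ring
  simp only [h_factor]
  rw [integral_const_mul, integral_exp_mul_sum_pi_eq_exp_mul_log μ₂ _ (hμ₂ _), ← hu₁,
    ← Real.exp_add, add_comm]
end
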